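/- arXiv:2312.15772 — 2 statements merged into one kernel-verified Lean document; each statement's English description precedes it below -/
import Mathlib

section
/- Let d ≥ 2, 1 < p₀ < d, 𝔇 = d − p₀, λ = 2^{(1−d)/𝔇}, γ ∈ ℝ, and let u be the subdimensional competitor on Ω = (−1,1)^d. Then u ∈ W^{1,1}(Ω), and: (i) ∇u ∈ L^{p₀−ε}(Ω) for every ε > 0; (ii) if γ = 0 then ∇u belongs to the weak Lebesgue space L^{p₀,∞}(Ω); (iii) if γ < −1/𝔇 then ∇u ∈ L^{p₀}(Ω). -/
open MeasureTheory Real Set Metric Filter Topology NNReal ENNReal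

noncomputable section

/-- `ℝ^n` with the Euclidean structure. -/
abbrev Euc (n : ℕ) := EuclideanSpace ℝ (Fin n)

/-- The open cube `(-1,1)^n`. -/
def Box (n : ℕ) : Set (Euc n) := {x | ∀ i, |x i| < 1}

/-- The last coordinate `x_d` of `x ∈ ℝ^{n+1}`. -/
def lastC {n : ℕ} (x : Euc (n + 1)) : ℝ := x (Fin.last n)

/-- The first `n` coordinates `x̄` of `x ∈ ℝ^{n+1}`. -/
def frontC {n : ℕ} (x : Euc (n + 1)) : Euc n := WithLp.toLp 2 fun i => x i.castSucc

/-- Assemble a point of `ℝ^{n+1}` from `x̄ ∈ ℝ^n` and a last coordinate. -/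
def snocC {n : ℕ} (xb : Euc n) (t : ℝ) : Euc (n + 1) :=
  WithLp.toLp 2 (Fin.snoc (α := fun _ => ℝ) (WithLp.ofLp xb) t)

/-- The first `m` coordinates of `x ∈ ℝ^{m+k}`. -/
def barPart {m k : ℕ} (x : Euc (m + k)) : Euc m := WithLp.toLp 2 fun i => x (Fin.castAdd k i)

/-- The last `k` coordinates of `x ∈ ℝ^{m+k}`. -/
def hatPart {m k : ℕ} (x : Euc (m + k)) : Euc k := WithLp.toLp 2 fun i => x (Fin.natAdd m i)

/-- Admissibility of a sequence of interval lengths for the generalized `(λ,γ)`-Cantor set: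
`l 0 = 1`, the lengths decrease fast enough (`l_{j-1} > 2 l_j`, removed gaps decreasing), and
`l j` is comparable to `λ^j j^γ`. -/
def IsCantorLengths (lam gam : ℝ) (l : ℕ → ℝ) : Prop :=
  l 0 = 1 ∧ (∀ j, 0 < l j) ∧ (∀ j, 2 * l (j + 1) < l j) ∧
    (∀ j, l (j + 1) - 2 * l (j + 2) < l j - 2 * l (j + 1)) ∧
    ∃ C : ℝ, 1 ≤ C ∧ ∀ j : ℕ, 1 ≤ j →
      C⁻¹ * lam ^ j * (j : ℝ) ^ gam ≤ l j ∧ l j ≤ C * lam ^ j * (j : ℝ) ^ gam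

/-- The point of the generalized Cantor set with address `ε` (left endpoints of the nested
intervals converge to this point). -/
def gCantorPoint (l : ℕ → ℝ) (ε : ℕ → Bool) : ℝ :=
  -(1 / 2 : ℝ) + ∑' j : ℕ, if ε j then l j - l (j + 1) else 0

/-- The generalized Cantor set determined by the lengths `l`. -/
def gCantorSet (l : ℕ → ℝ) : Set ℝ := Set.range (gCantorPoint l)

/-- The `m`-fold Cartesian power of the generalized Cantor set, inside `ℝ^m`. -/
def gCantorSetPi (l : ℕ → ℝ) (m : ℕ) : Set (Euc m) := {x | ∀ i, x i ∈ gCantorSet l}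

/-- The `j`-th binary digit of `t`. -/
def binDigit (t : ℝ) (j : ℕ) : Bool := ⌊t * 2 ^ (j + 1)⌋ % 2 = 1

/-- The Cantor measure attached to the lengths `l`: the image of the uniform distribution on
`[0,1)` under the map sending `t` to the Cantor point whose address is the binary digit
sequence of `t` (the digits being i.i.d. fair coins, this is the weak limit of the uniform
distributions on the pre-Cantor sets). -/
def gCantorMeasure (l : ℕ → ℝ) : Measure ℝ :=
  Measure.map (fun t => gCantorPoint l (binDigit t)) (volume.restrict (Set.Ico (0 : ℝ) 1))

/-- The `m`-fold product of the Cantor measure, as a measure on `ℝ^m`. -/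
def gCantorMeasurePi (l : ℕ → ℝ) (m : ℕ) : Measure (Euc m) :=
  Measure.map (⇑(MeasurableEquiv.toLp 2 (Fin m → ℝ)))
    (Measure.pi fun _ : Fin m => gCantorMeasure l)

/-- The fractal dimension `𝔇 = m log 2 / log(1/λ)`. -/
def frD (m : ℕ) (lam : ℝ) : ℝ := m * Real.log 2 / Real.log lam⁻¹

/-- `G` is the weak (distributional) differential of `u` on `Ω`:
integration by parts against smooth compactly supported test functions holds. -/
def HasWeakFDerivOn {n : ℕ} (Ω : Set (Euc n)) (u : Euc n → ℝ)
    (G : Euc n → Euc n →L[ℝ] ℝ) : Prop :=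
  ∀ φ : Euc n → ℝ, ContDiff ℝ (⊤ : ℕ∞) φ → HasCompactSupport φ → tsupport φ ⊆ Ω →
    ∫ x in Ω, u x • fderiv ℝ φ x = -∫ x in Ω, φ x • G x

/-- `u ∈ W^{1,1}(Ω)` with weak differential `G`. -/
def W11On {n : ℕ} (Ω : Set (Euc n)) (u : Euc n → ℝ) (G : Euc n → Euc n →L[ℝ] ℝ) : Prop :=
  IntegrableOn u Ω ∧ IntegrableOn G Ω ∧ HasWeakFDerivOn Ω u G

/-- `w ∈ W^{1,1}_0(Ω)` (with weak differential `G`): the extensions by zero form a Sobolev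
function on all of `ℝ^n`. -/
def ZeroBoundary {n : ℕ} (Ω : Set (Euc n)) (w : Euc n → ℝ)
    (G : Euc n → Euc n →L[ℝ] ℝ) : Prop :=
  Integrable (Set.indicator Ω w) ∧ Integrable (Set.indicator Ω G) ∧
    HasWeakFDerivOn Set.univ (Set.indicator Ω w) (Set.indicator Ω G)

/-- The energy `∫_Ω φ(x, g x) dx` for a scalar field `g` (typically `g = |∇w|`). -/
def energyOf {n : ℕ} (Ω : Set (Euc n)) (φ : Euc n → ℝ → ℝ) (g : Euc n → ℝ) : ℝ≥0∞ :=
  ∫⁻ x in Ω, ENNReal.ofReal (φ x (g x))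

/-- The Young (Legendre–Fenchel) conjugate `φ*(s) = sup_{t ≥ 0} (s t − φ(t))`. -/
def conjOrlicz (φ : ℝ → ℝ) (s : ℝ) : ℝ≥0∞ :=
  ⨆ t : ℝ≥0, ENNReal.ofReal (s * t - φ t)

/-- The conjugate energy `∫_Ω φ*(x, g x) dx`. -/
def energyConj {n : ℕ} (Ω : Set (Euc n)) (φ : Euc n → ℝ → ℝ) (g : Euc n → ℝ) : ℝ≥0∞ :=
  ∫⁻ x in Ω, conjOrlicz (φ x) (g x)

/-- `u` (with weak differential `G`, finite energy) is a local minimizer of the functional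
`w ↦ ∫_Ω φ(x,|∇w|) dx`: its energy does not exceed that of any Sobolev competitor that agrees
with `u` a.e. outside a compact subset of `Ω`. -/
def IsLocalMinimizer {n : ℕ} (Ω : Set (Euc n)) (φ : Euc n → ℝ → ℝ) (u : Euc n → ℝ)
    (G : Euc n → Euc n →L[ℝ] ℝ) : Prop :=
  W11On Ω u G ∧ energyOf Ω φ (fun x => ‖G x‖) < ⊤ ∧
    ∀ v Gv, W11On Ω v Gv →
      (∃ K : Set (Euc n), IsCompact K ∧ K ⊆ Ω ∧ ∀ᵐ x ∂(volume.restrict Ω), x ∉ K → v x = u x) →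
      energyOf Ω φ (fun x => ‖G x‖) ≤ energyOf Ω φ (fun x => ‖Gv x‖)

/-- `x` is a non-Lebesgue point of `u`: the averages of `|u − c|` on small balls around `x`
do not converge to `0` for any constant `c`. -/
def IsNonLebesguePoint {n : ℕ} (u : Euc n → ℝ) (x : Euc n) : Prop :=
  ¬ ∃ c : ℝ, Tendsto (fun r : ℝ => ⨍ y in Metric.ball x r, |u y - c| ∂volume)
      (𝓝[>] (0 : ℝ)) (𝓝 0)

/-- Membership in the Hölder class `C^α` on `s` (for `α ≥ 1` interpreted via
`C^{⌊α⌋, α − ⌊α⌋}`). -/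
def InHolderCls {n : ℕ} (α : ℝ) (s : Set (Euc n)) (a : Euc n → ℝ) : Prop :=
  ContDiffOn ℝ (⌊α⌋₊ : ℕ) a s ∧
    ∃ C : ℝ≥0, HolderOnWith C (Real.toNNReal (α - ⌊α⌋₊))
      (fun x => iteratedFDerivWithin ℝ ⌊α⌋₊ a s x) s

/-- The restricted Riesz potential `I₁^⋈(|f|)(x̄,0) = ∫_{C((x̄,0))} |f(y)| |x−y|^{1−d} dy`,
where `C(x)` is the double cone `{y : |ȳ − x̄| ≤ |y_d − x_d|/2}` (here `d = n+1`). -/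
def rieszBow {n : ℕ} (f : Euc (n + 1) → ℝ) (xb : Euc n) : ℝ≥0∞ :=
  ∫⁻ y : Euc (n + 1),
    ENNReal.ofReal ((if dist (frontC y) xb ≤ |lastC y| / 2 then (1 : ℝ) else 0) *
      |f y| * Real.sqrt (dist (frontC y) xb ^ 2 + lastC y ^ 2) ^ (-(n : ℝ)))

/-- The upper average `⟨f⟩⁺_{x̄,r} = ∫_{B_1} ω(y) f(x̄ + |r| ȳ, |r| y_d + |r|) dy`. -/
def avgPlus {n : ℕ} (ω : Euc (n + 1) → ℝ) (f : Euc (n + 1) → ℝ) (xb : Euc n) (r : ℝ) : ℝ :=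
  ∫ y in Metric.ball (0 : Euc (n + 1)) 1,
    ω y * f (snocC (xb + |r| • frontC y) (|r| * lastC y + |r|))

/-- The lower average `⟨f⟩⁻_{x̄,r} = ∫_{B_1} ω(y) f(x̄ + |r| ȳ, |r| y_d − |r|) dy`. -/
def avgMinus {n : ℕ} (ω : Euc (n + 1) → ℝ) (f : Euc (n + 1) → ℝ) (xb : Euc n) (r : ℝ) : ℝ :=
  ∫ y in Metric.ball (0 : Euc (n + 1)) 1,
    ω y * f (snocC (xb + |r| • frontC y) (|r| * lastC y - |r|))

open Classical in
/-- The function `u_d(x) = (1/2) sgn(x_d) θ(|x_d|/|x̄|)` (extended by its natural limit value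
`(1/2) sgn(x_d)` on the line `x̄ = 0`). -/
def uD {n : ℕ} (θ : ℝ → ℝ) (x : Euc (n + 1)) : ℝ :=
  if frontC x = 0 then (1 / 2) * Real.sign (lastC x)
  else (1 / 2) * Real.sign (lastC x) * θ (|lastC x| / ‖frontC x‖)

/-- Hypotheses on the profile function `θ`:
smooth on `(0,∞)`, `1_{(1/2,∞)} ≤ θ ≤ 1_{(1/4,∞)}` and `‖θ'‖_∞ ≤ 6`. -/
def IsProfile (θ : ℝ → ℝ) : Prop :=
  ContDiffOn ℝ (⊤ : ℕ∞) θ (Set.Ioi 0) ∧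
    (∀ t : ℝ, 0 < t → (if 1 / 2 < t then (1 : ℝ) else 0) ≤ θ t) ∧
    (∀ t : ℝ, 0 < t → θ t ≤ if 1 / 4 < t then 1 else 0) ∧
    (∀ t : ℝ, 0 < t → |deriv θ t| ≤ 6)

end

noncomputable def WW (l : ℕ → ℝ) (n : ℕ) (x : Euc (n + 1)) : ℝ :=
  if Metric.infDist (frontC x) (gCantorSetPi l n) ≤ 4 * |lastC x| then |lastC x|⁻¹ else 0

noncomputable def aE (l : ℕ → ℝ) (m : ℕ) (e : Fin m → Bool) : ℝ :=
  -(1 / 2) + ∑ j : Fin m, if e j then l j - l (j + 1) else 0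

noncomputable def SS (l : ℕ → ℝ) (m : ℕ) : Set ℝ :=
  ⋃ e : Fin m → Bool, Set.Icc (aE l m e - 5 * l m) (aE l m e + 6 * l m)

noncomputable def EE (l : ℕ → ℝ) (n m : ℕ) : Set (Euc (n + 1)) :=
  {x | |lastC x| ≤ l m ∧ ∀ i : Fin n, x i.castSucc ∈ SS l m}

lemma cl_tendsto {lam gam : ℝ} {l : ℕ → ℝ} (hl : IsCantorLengths lam gam l) :
    Tendsto l atTop (𝓝 0) := by
  obtain ⟨h0, hpos, h2, -⟩ := hl
  have hb : ∀ m, l m ≤ (1 / 2 : ℝ) ^ m := by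
    intro m
    induction m with
    | zero => simp [h0]
    | succ k ih => rw [pow_succ]; linarith [h2 k]
  exact squeeze_zero (fun m => (hpos m).le) hb
    (tendsto_pow_atTop_nhds_zero_of_lt_one (by norm_num) (by norm_num))

lemma cl_tail {lam gam : ℝ} {l : ℕ → ℝ} (hl : IsCantorLengths lam gam l) (m : ℕ) :
    HasSum (fun j => l (j + m) - l (j + m + 1)) (l m) := by
  have hpos := hl.2.1
  have h2 := hl.2.2.1
  rw [hasSum_iff_tendsto_nat_of_nonneg]
  · have : (fun N => ∑ i ∈ Finset.range N, (l (i + m) - l (i + m + 1))) =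
        fun N => l m - l (N + m) := by
      funext N
      induction N with
      | zero => simp
      | succ k ih => rw [Finset.sum_range_succ, ih]; rw [show k + 1 + m = k + m + 1 by ring]; ring
    rw [this]
    have h := (cl_tendsto hl).comp (tendsto_add_atTop_nat m)
    simpa using (tendsto_const_nhds (x := l m)).sub h
  · intro i
    linarith [h2 (i + m), hpos (i + m + 1)]

lemma gC_mem {lam gam : ℝ} {l : ℕ → ℝ} (hl : IsCantorLengths lam gam l) (m : ℕ) {c : ℝ}
    (hc : c ∈ gCantorSet l) : ∃ e : Fin m → Bool, aE l m e ≤ c ∧ c ≤ aE l m e + l m := by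
  obtain ⟨ε, rfl⟩ := hc
  have hpos := hl.2.1
  have h2 := hl.2.2.1
  have hd : ∀ j, 0 ≤ l j - l (j + 1) := fun j => by linarith [h2 j, hpos (j + 1)]
  have hn : ∀ j, 0 ≤ (if ε j then l j - l (j + 1) else 0) := by
    intro j; split_ifs <;> simp [hd j]
  have hle : ∀ j, (if ε j then l j - l (j + 1) else 0) ≤ l j - l (j + 1) := by
    intro j; split_ifs <;> simp [hd j]
  have hs : Summable (fun j => if ε j then l j - l (j + 1) else 0) :=
    Summable.of_nonneg_of_le hn hle (cl_tail hl 0).summable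
  refine ⟨fun j => ε j, ?_⟩
  have key := hs.sum_add_tsum_nat_add m
  have h1 : 0 ≤ ∑' j, (if ε (j + m) then l (j + m) - l (j + m + 1) else 0) :=
    tsum_nonneg fun j => hn (j + m)
  have h3 : ∑' j, (if ε (j + m) then l (j + m) - l (j + m + 1) else 0) ≤ l m := by
    rw [← (cl_tail hl m).tsum_eq]
    exact Summable.tsum_le_tsum (fun j => hle (j + m))
      ((_root_.summable_nat_add_iff m).2 hs) (cl_tail hl m).summable
  rw [Finset.sum_range] at key
  unfold gCantorPoint aE
  rw [← key]
  constructor <;> linarith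

lemma gC_nonempty (l : ℕ → ℝ) (n : ℕ) : (gCantorSetPi l n).Nonempty :=
  ⟨WithLp.toLp 2 fun _ => gCantorPoint l (fun _ => true), fun _ => ⟨_, rfl⟩⟩

lemma mem_EE {lam gam : ℝ} {l : ℕ → ℝ} (hl : IsCantorLengths lam gam l) {n : ℕ} (m : ℕ)
    {x : Euc (n + 1)} (hx0 : lastC x ≠ 0)
    (hx : Metric.infDist (frontC x) (gCantorSetPi l n) ≤ 4 * |lastC x|) (hxm : |lastC x| ≤ l m) :
    x ∈ EE l n m := by
  refine ⟨hxm, fun i => ?_⟩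
  have hp : 0 < |lastC x| := abs_pos.2 hx0
  obtain ⟨c, hc, hd⟩ := (Metric.infDist_lt_iff (gC_nonempty l n)).1
    (lt_of_le_of_lt hx (show 4 * |lastC x| < 5 * |lastC x| by linarith))
  have h1 : |x i.castSucc - c i| ≤ 5 * l m := by
    have h := EuclideanSpace.norm_eq (frontC x - c)
    have h2 : ‖(frontC x - c) i‖ ≤ ‖frontC x - c‖ := PiLp.norm_apply_le _ i
    rw [← dist_eq_norm] at h2
    have h3 : ‖(frontC x - c) i‖ = |x i.castSucc - c i| := by
      simp [frontC, Real.norm_eq_abs]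
    rw [← h3]; linarith
  obtain ⟨e, he1, he2⟩ := gC_mem hl m (hc i)
  rw [abs_le] at h1
  exact Set.mem_iUnion.2 ⟨e, by constructor <;> linarith [h1.1, h1.2]⟩

lemma meas_SS (l : ℕ → ℝ) (m : ℕ) : MeasurableSet (SS l m) :=
  MeasurableSet.iUnion fun _ => measurableSet_Icc

lemma EE_eq (l : ℕ → ℝ) (n m : ℕ) : EE l n m = (WithLp.ofLp : Euc (n+1) → (Fin (n+1) → ℝ)) ⁻¹'
    (Set.pi Set.univ (Fin.snoc (α := fun _ => Set ℝ) (fun _ : Fin n => SS l m)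
      (Set.Icc (-l m) (l m)))) := by
  ext x
  simp only [EE, lastC, Set.mem_ofPred_eq, Set.mem_preimage, Set.mem_pi, Set.mem_univ, true_imp_iff]
  rw [Fin.forall_fin_succ']
  simp [abs_le, and_comm]

lemma meas_EE (l : ℕ → ℝ) (n m : ℕ) : MeasurableSet (EE l n m) := by
  rw [EE_eq]
  refine (EuclideanSpace.volume_preserving_symm_measurableEquiv_toLp (Fin (n+1))).measurable ?_
  refine MeasurableSet.univ_pi fun i => ?_
  refine Fin.lastCases ?_ (fun i => ?_) i
  · simp
  · simp [meas_SS]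

lemma vol_SS {l : ℕ → ℝ} (_hpos : ∀ j, 0 < l j) (m : ℕ) :
    volume (SS l m) ≤ ENNReal.ofReal (2 ^ m * (11 * l m)) := by
  refine (measure_iUnion_fintype_le _ _).trans ?_
  have h : ∀ e : Fin m → Bool, volume (Set.Icc (aE l m e - 5 * l m) (aE l m e + 6 * l m)) =
      ENNReal.ofReal (11 * l m) := by
    intro e; rw [Real.volume_Icc]; congr 1; ring
  simp only [h, Finset.sum_const, Finset.card_univ, Fintype.card_fun, Fintype.card_bool,
    Fintype.card_fin, nsmul_eq_mul]
  rw [ENNReal.ofReal_mul (by positivity)]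
  simp [ENNReal.ofReal_pow]

lemma vol_EE {l : ℕ → ℝ} (hpos : ∀ j, 0 < l j) (n m : ℕ) :
    volume (EE l n m) ≤ ENNReal.ofReal (2 * 11 ^ n * (2 ^ (m * n) * l m ^ (n + 1))) := by
  rw [EE_eq]
  refine (le_of_eq ((EuclideanSpace.volume_preserving_symm_measurableEquiv_toLp
    (Fin (n+1))).measure_preimage_emb (MeasurableEquiv.measurableEmbedding _) _)).trans ?_
  rw [volume_pi, Measure.pi_pi, Fin.prod_univ_castSucc]
  simp only [Fin.snoc_castSucc, Fin.snoc_last, Finset.prod_const, Finset.card_univ,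
    Fintype.card_fin, Real.volume_Icc]
  have hm := hpos m
  calc _ ≤ ENNReal.ofReal (2 ^ m * (11 * l m)) ^ n * ENNReal.ofReal (l m - -l m) := by
        gcongr; exact vol_SS hpos m
    _ = _ := by
        rw [← ENNReal.ofReal_pow (by positivity), ← ENNReal.ofReal_mul (by positivity)]
        congr 1; rw [mul_pow, mul_pow, ← pow_mul]; ring

lemma cl_ratio {lam gam : ℝ} {l : ℕ → ℝ} (hl : IsCantorLengths lam gam l) (hlam : 0 < lam) :
    ∃ K : ℝ, 1 ≤ K ∧ ∀ m, l m ≤ K * l (m + 1) := by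
  obtain ⟨h0, hpos, h2, -, C, hC, hb⟩ := hl
  have hC0 : 0 < C := by linarith
  refine ⟨max (max 1 (l 0 / l 1)) (C * C * lam⁻¹ * 2 ^ |gam|), ?_, ?_⟩
  · exact (le_max_left _ _).trans (le_max_left _ _)
  · intro m
    rcases Nat.eq_zero_or_pos m with rfl | hm
    · calc l 0 = l 0 / l 1 * l 1 := by field_simp [(hpos 1).ne']
        _ ≤ _ := by
          have := hpos 1
          simp only [zero_add]
          gcongr
          exact (le_max_right _ _).trans (le_max_left _ _)
    · have hm' : (1 : ℝ) ≤ m := by exact_mod_cast hm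
      have h1 := (hb m hm).2
      have h3 := (hb (m + 1) (by omega)).1
      have hg : (m : ℝ) ^ gam ≤ 2 ^ |gam| * ((m + 1 : ℕ) : ℝ) ^ gam := by
        push_cast
        rcases le_or_gt 0 gam with hg | hg
        · have : (m : ℝ) ^ gam ≤ ((m : ℝ) + 1) ^ gam := by gcongr; linarith
          have h4 : (1 : ℝ) ≤ 2 ^ |gam| := Real.one_le_rpow (by norm_num) (abs_nonneg _)
          have h5 : 0 ≤ ((m : ℝ) + 1) ^ gam := by positivity
          nlinarith
        · rw [abs_of_neg hg]
          have h5 : (m : ℝ) ^ gam = 2 ^ (-gam) * (2 * (m : ℝ)) ^ gam := by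
            rw [Real.mul_rpow (by norm_num) (by positivity), ← mul_assoc,
              ← Real.rpow_add (by norm_num)]
            simp
          rw [h5]
          gcongr ?_ * ?_
          exact Real.rpow_le_rpow_of_nonpos (by positivity) (by linarith) hg.le
      calc l m ≤ C * lam ^ m * (m : ℝ) ^ gam := h1
        _ ≤ C * lam ^ m * (2 ^ |gam| * ((m + 1 : ℕ) : ℝ) ^ gam) := by gcongr
        _ = (C * C * lam⁻¹ * 2 ^ |gam|) * (C⁻¹ * lam ^ (m + 1) * ((m + 1 : ℕ) : ℝ) ^ gam) := by
          rw [pow_succ]; field_simp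
        _ ≤ (C * C * lam⁻¹ * 2 ^ |gam|) * l (m + 1) := by gcongr
        _ ≤ _ := by
          have := hpos (m + 1)
          gcongr
          exact le_max_right _ _

lemma cl_shell {lam gam : ℝ} {l : ℕ → ℝ} (hl : IsCantorLengths lam gam l) {t : ℝ} (ht : 0 < t)
    (ht1 : t ≤ 1) : ∃ m, l (m + 1) < t ∧ t ≤ l m := by
  classical
  have hex : ∃ m, l m < t := ((cl_tendsto hl).eventually_lt_const ht).exists
  have hf := Nat.find_spec hex
  have h0 : Nat.find hex ≠ 0 := by
    intro h
    rw [h, hl.1] at hf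
    linarith
  obtain ⟨m, hm⟩ := Nat.exists_eq_succ_of_ne_zero h0
  refine ⟨m, by rw [hm] at hf; exact hf, ?_⟩
  exact not_lt.1 (Nat.find_min hex (m := m) (by omega))

lemma cont_front {n : ℕ} : Continuous (frontC : Euc (n + 1) → Euc n) := by
  unfold frontC; fun_prop

lemma cont_last {n : ℕ} : Continuous (lastC : Euc (n + 1) → ℝ) := by
  unfold lastC; fun_prop

lemma meas_WW (l : ℕ → ℝ) (n : ℕ) : Measurable (WW l n) := by
  unfold WW
  refine Measurable.ite ?_ ?_ measurable_const
  · exact measurableSet_le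
      ((Metric.continuous_infDist_pt _).comp cont_front).measurable
      (measurable_const.mul cont_last.measurable.abs)
  · exact cont_last.measurable.abs.inv

lemma memLp_WW {lam gam : ℝ} {l : ℕ → ℝ} (hl : IsCantorLengths lam gam l) (hlam : 0 < lam)
    {n : ℕ} {p : ℝ} (hp : 0 < p)
    (hs : Summable fun m : ℕ => (2 : ℝ) ^ (m * n) * l m ^ ((n : ℝ) + 1 - p)) :
    MemLp (WW l n) (ENNReal.ofReal p) (volume.restrict (Box (n + 1))) := by
  refine ⟨(meas_WW l n).aestronglyMeasurable, ?_⟩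
  have hpos := hl.2.1
  obtain ⟨K, hK, hr⟩ := cl_ratio hl hlam
  rw [eLpNorm_lt_top_iff_lintegral_rpow_enorm_lt_top (by simpa using hp) ENNReal.ofReal_ne_top,
    ENNReal.toReal_ofReal hp.le]
  have hBox : MeasurableSet (Box (n + 1)) := by
    have : Box (n + 1) = ⋂ i, {x : Euc (n + 1) | |x i| < 1} := by
      ext x; simp [Box]
    rw [this]
    exact MeasurableSet.iInter fun i => measurableSet_lt (by fun_prop) measurable_const
  have hpt : ∀ x ∈ Box (n + 1), ‖WW l n x‖ₑ ^ p ≤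
      ∑' m, (EE l n m).indicator (fun _ => ENNReal.ofReal (l (m + 1) ^ (-p))) x := by
    intro x hx
    unfold WW
    split_ifs with hd
    · by_cases h0 : lastC x = 0
      · simp [h0, hp]
      · have ha : 0 < |lastC x| := abs_pos.2 h0
        obtain ⟨m, hm1, hm2⟩ := cl_shell hl ha (hx (Fin.last n)).le
        refine le_trans ?_ (ENNReal.le_tsum m)
        rw [Set.indicator_of_mem (mem_EE hl m h0 hd hm2), Real.enorm_eq_ofReal (by positivity),
          ENNReal.ofReal_rpow_of_pos (by positivity)]
        apply ENNReal.ofReal_le_ofReal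
        rw [Real.inv_rpow ha.le, ← Real.rpow_neg ha.le]
        exact Real.rpow_le_rpow_of_nonpos (hpos _) hm1.le (by linarith)
    · simp [hp]
  refine lt_of_le_of_lt (setLIntegral_mono' hBox hpt) ?_
  refine lt_of_le_of_lt (setLIntegral_le_lintegral _ _) ?_
  rw [lintegral_tsum (fun m => (measurable_const.indicator (meas_EE l n m)).aemeasurable)]
  have hterm : ∀ m, ∫⁻ x, (EE l n m).indicator (fun _ => ENNReal.ofReal (l (m + 1) ^ (-p))) x ≤
      ENNReal.ofReal ((K ^ p * (2 * 11 ^ n)) * ((2 : ℝ) ^ (m * n) * l m ^ ((n : ℝ) + 1 - p))) := by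
    intro m
    rw [lintegral_indicator_const (meas_EE l n m)]
    have h1 := hpos m
    have h2 := hpos (m + 1)
    have hK0 : 0 < K := by linarith
    calc _ ≤ ENNReal.ofReal (l (m + 1) ^ (-p)) *
          ENNReal.ofReal (2 * 11 ^ n * (2 ^ (m * n) * l m ^ (n + 1))) := by
            gcongr; exact vol_EE hpos n m
      _ = ENNReal.ofReal (l (m + 1) ^ (-p) * (2 * 11 ^ n * (2 ^ (m * n) * l m ^ (n + 1)))) := by
            rw [← ENNReal.ofReal_mul (by positivity)]
      _ ≤ _ := by
        apply ENNReal.ofReal_le_ofReal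
        have h3 : l (m + 1) ^ (-p) ≤ K ^ p * l m ^ (-p) := by
          have : (K * l (m + 1)) ^ (-p) ≤ l m ^ (-p) :=
            Real.rpow_le_rpow_of_nonpos h1 (hr m) (by linarith)
          rw [Real.mul_rpow hK0.le h2.le] at this
          calc l (m + 1) ^ (-p) = K ^ p * (K ^ (-p) * l (m + 1) ^ (-p)) := by
                rw [← mul_assoc, ← Real.rpow_add hK0]; simp
            _ ≤ _ := by gcongr
        have h4 : l m ^ ((n : ℝ) + 1 - p) = l m ^ (n + 1) * l m ^ (-p) := by
          rw [← Real.rpow_natCast, ← Real.rpow_add h1]; push_cast; ring_nf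
        rw [h4]
        calc _ ≤ K ^ p * l m ^ (-p) * (2 * 11 ^ n * (2 ^ (m * n) * l m ^ (n + 1))) := by gcongr
          _ = _ := by ring
  refine lt_of_le_of_lt (ENNReal.tsum_le_tsum hterm) ?_
  exact (hs.mul_left _).tsum_ofReal_lt_top

lemma cl_summ {lam gam : ℝ} {l : ℕ → ℝ} (hl : IsCantorLengths lam gam l) (hlam : 0 < lam)
    {n : ℕ} {q : ℝ} (hq : 0 < q)
    (hs : Summable fun m : ℕ => ((2 : ℝ) ^ n * lam ^ q) ^ m * (m : ℝ) ^ (gam * q)) :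
    Summable fun m : ℕ => (2 : ℝ) ^ (m * n) * l m ^ q := by
  have hpos := hl.2.1
  obtain ⟨C, hC, hb⟩ := hl.2.2.2.2
  have hC0 : 0 < C := by linarith
  refine Summable.of_norm_bounded_eventually_nat (hs.mul_left (C ^ q)) ?_
  filter_upwards [eventually_ge_atTop 1] with m hm
  have h1 := hpos m
  rw [Real.norm_of_nonneg (by positivity)]
  calc (2 : ℝ) ^ (m * n) * l m ^ q ≤ (2 : ℝ) ^ (m * n) * (C * lam ^ m * (m : ℝ) ^ gam) ^ q := by
        gcongr; exact (hb m hm).2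
    _ = _ := by
      rw [Real.mul_rpow (by positivity) (by positivity), Real.mul_rpow (by positivity) (by positivity),
        mul_pow, ← Real.rpow_mul (by positivity), ← Real.rpow_natCast lam m,
        ← Real.rpow_natCast (lam ^ q) m, ← Real.rpow_mul hlam.le, ← Real.rpow_mul hlam.le,
        mul_comm q, pow_mul', ]
      ring

lemma summ_geo {r s : ℝ} (hr0 : 0 ≤ r) (hr : r < 1) :
    Summable fun m : ℕ => r ^ m * (m : ℝ) ^ s := by
  have h := summable_pow_mul_geometric_of_norm_lt_one (R := ℝ) ⌈s⌉₊ (r := r)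
    (by rwa [Real.norm_of_nonneg hr0])
  refine Summable.of_norm_bounded_eventually_nat h ?_
  filter_upwards [eventually_ge_atTop 1] with m hm
  have hm' : (1 : ℝ) ≤ m := by exact_mod_cast hm
  rw [Real.norm_of_nonneg (by positivity), mul_comm]
  gcongr
  rw [← Real.rpow_natCast]
  exact Real.rpow_le_rpow_of_exponent_le hm' (Nat.le_ceil s)

lemma weak_WW {lam : ℝ} {l : ℕ → ℝ} (hl : IsCantorLengths lam 0 l) (hlam : 0 < lam)
    {n : ℕ} {D : ℝ} (hD : 0 < D) (hDn : D < (n : ℝ) + 1) (h2 : (2 : ℝ) ^ n * lam ^ D = 1) :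
    ∃ C : ℝ, 0 < C ∧ ∀ t : ℝ, 0 < t →
      volume {x ∈ Box (n + 1) | t < WW l n x} ≤
        ENNReal.ofReal (C * t ^ (-((n : ℝ) + 1 - D))) := by
  have hpos := hl.2.1
  obtain ⟨K, hK, hr⟩ := cl_ratio hl hlam
  obtain ⟨C, hC, hb⟩ := hl.2.2.2.2
  have hC0 : 0 < C := by linarith
  have hK0 : 0 < K := by linarith
  set p := (n : ℝ) + 1 - D with hpdef
  have hp : 0 < p := by linarith
  -- volume bound
  have hv : ∀ m, volume (EE l n m) ≤ ENNReal.ofReal (2 * 11 ^ n * C ^ D * l m ^ p) := by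
    intro m
    refine (vol_EE hpos n m).trans (ENNReal.ofReal_le_ofReal ?_)
    have h1 := hpos m
    have hCD : 1 ≤ C ^ D := Real.one_le_rpow hC hD.le
    have h3 : (2 : ℝ) ^ (m * n) * l m ^ D ≤ C ^ D := by
      rcases Nat.eq_zero_or_pos m with rfl | hm
      · simp [hl.1, hCD]
      · have h4 := (hb m hm).2
        rw [Real.rpow_zero, mul_one] at h4
        calc (2 : ℝ) ^ (m * n) * l m ^ D ≤ (2 : ℝ) ^ (m * n) * (C * lam ^ m) ^ D := by gcongr
          _ = C ^ D * ((2 : ℝ) ^ n * lam ^ D) ^ m := by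
            rw [Real.mul_rpow (by positivity) (by positivity), mul_pow,
              ← Real.rpow_natCast lam m,
              ← Real.rpow_natCast (lam ^ D) m, ← Real.rpow_mul hlam.le, ← Real.rpow_mul hlam.le,
              mul_comm D, pow_mul']
            ring
          _ = C ^ D := by rw [h2]; simp
    have h4 : l m ^ (n + 1) = l m ^ D * l m ^ p := by
      rw [← Real.rpow_natCast, ← Real.rpow_add h1, hpdef]; push_cast; ring_nf
    rw [h4]
    calc 2 * 11 ^ n * ((2 : ℝ) ^ (m * n) * (l m ^ D * l m ^ p)) =
        2 * 11 ^ n * ((2 : ℝ) ^ (m * n) * l m ^ D) * l m ^ p := by ring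
      _ ≤ _ := by gcongr
  refine ⟨2 * 11 ^ n * C ^ D * K ^ p, by positivity, fun t ht => ?_⟩
  have hsub : ∀ m, min 1 t⁻¹ ≤ l m → {x ∈ Box (n + 1) | t < WW l n x} ⊆ EE l n m := by
    rintro m hm x ⟨hx, hxt⟩
    unfold WW at hxt
    split_ifs at hxt with hd
    · have h0 : lastC x ≠ 0 := by
        intro h; simp [h] at hxt; linarith
      refine mem_EE hl m h0 hd (le_trans (le_min (hx (Fin.last n)).le ?_) hm)
      exact (le_inv_comm₀ ht (abs_pos.2 h0)).1 hxt.le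
    · linarith
  obtain ⟨m, hm1, hm2⟩ := cl_shell hl (t := min 1 t⁻¹) (by positivity) (min_le_left _ _)
  refine (measure_mono (hsub m hm2)).trans ((hv m).trans (ENNReal.ofReal_le_ofReal ?_))
  have h1 := hpos m
  have h2 := hpos (m + 1)
  calc 2 * 11 ^ n * C ^ D * l m ^ p ≤ 2 * 11 ^ n * C ^ D * (K * t⁻¹) ^ p := by
        gcongr
        refine (hr m).trans ?_
        gcongr
        exact hm1.le.trans (min_le_right _ _)
    _ = _ := by
      rw [Real.mul_rpow hK0.le (by positivity), Real.inv_rpow ht.le, ← Real.rpow_neg ht.le]; ring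

lemma null_last {n : ℕ} : volume {x : Euc (n + 1) | lastC x = 0} = 0 := by
  let L : Euc (n + 1) →ₗ[ℝ] ℝ := (EuclideanSpace.proj (𝕜 := ℝ) (Fin.last n)).toLinearMap
  have h : {x : Euc (n + 1) | lastC x = 0} = (LinearMap.ker L : Set (Euc (n + 1))) := by
    ext x; simp [L, lastC]
  rw [h]
  refine Measure.addHaar_submodule volume _ ?_
  intro ht
  have : EuclideanSpace.single (Fin.last n) (1 : ℝ) ∈ LinearMap.ker L := by rw [ht]; trivial
  simp [L] at this

lemma open_last {n : ℕ} : IsOpen {x : Euc (n + 1) | lastC x ≠ 0} :=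
  isOpen_ne_fun cont_last continuous_const

lemma ae_last {n : ℕ} : ∀ᵐ x : Euc (n + 1), lastC x ≠ 0 := by
  rw [ae_iff]; simpa using null_last

noncomputable def etaF (s : ℝ) : ℝ := Real.smoothTransition (s ^ 2 - 1)

lemma etaF_contDiff : ContDiff ℝ (⊤ : ℕ∞) etaF := by
  unfold etaF
  exact Real.smoothTransition.contDiff.comp ((contDiff_id.pow 2).sub contDiff_const)

lemma etaF_zero {s : ℝ} (hs : |s| ≤ 1) : etaF s = 0 := by
  apply Real.smoothTransition.zero_of_nonpos
  have := (sq_le_one_iff_abs_le_one s).2 hs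
  linarith

lemma etaF_one {s : ℝ} (hs : 3 / 2 ≤ |s|) : etaF s = 1 := by
  apply Real.smoothTransition.one_of_one_le
  have : (3 / 2) ^ 2 ≤ |s| ^ 2 := by gcongr
  rw [sq_abs] at this
  linarith

lemma etaF_abs (s : ℝ) : |etaF s| ≤ 1 := by
  unfold etaF
  rw [abs_of_nonneg (Real.smoothTransition.nonneg _)]
  exact Real.smoothTransition.le_one _

lemma etaF_deriv_zero {s : ℝ} (hs : 2 ≤ |s|) : deriv etaF s = 0 := by
  have : etaF =ᶠ[𝓝 s] fun _ => (1 : ℝ) := by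
    have ho : ∀ᶠ y in 𝓝 s, 3 / 2 < |y| :=
      continuous_abs.continuousAt.eventually (lt_mem_nhds (by linarith))
    filter_upwards [ho] with y hy using etaF_one hy.le
  rw [this.deriv_eq]; simp

lemma etaF_deriv_bound : ∃ M : ℝ, 0 ≤ M ∧ ∀ s, |s| * |deriv etaF s| ≤ M := by
  have hc : Continuous fun s => |s| * |deriv etaF s| :=
    continuous_abs.mul (etaF_contDiff.continuous_deriv (by simp)).abs
  obtain ⟨M, hM⟩ := (isCompact_Icc (a := (-2 : ℝ)) (b := 2)).exists_bound_of_continuousOn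
    hc.continuousOn
  refine ⟨max M 0, le_max_right _ _, fun s => ?_⟩
  by_cases hs : |s| ≤ 2
  · have := hM s (abs_le.1 hs)
    rw [Real.norm_of_nonneg (by positivity)] at this
    exact this.trans (le_max_left _ _)
  · rw [etaF_deriv_zero (not_le.1 hs).le]; simp

lemma hasFDerivAt_last {n : ℕ} (x : Euc (n + 1)) :
    HasFDerivAt (lastC : Euc (n + 1) → ℝ) (EuclideanSpace.proj (𝕜 := ℝ) (Fin.last n)) x :=
  (EuclideanSpace.proj (𝕜 := ℝ) (Fin.last n) : Euc (n + 1) →L[ℝ] ℝ).hasFDerivAt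

lemma abs_last_le {n : ℕ} (x : Euc (n + 1)) : |lastC x| ≤ ‖x‖ := by
  simpa [lastC] using PiLp.norm_apply_le x (Fin.last n)

lemma fderiv_cut {n : ℕ} {u : Euc (n + 1) → ℝ} (k : ℝ) {x : Euc (n + 1)}
    (hu : DifferentiableAt ℝ u x) (v : Euc (n + 1)) :
    fderiv ℝ (fun y => etaF (k * lastC y) * u y) x v =
      etaF (k * lastC x) * fderiv ℝ u x v + u x * (deriv etaF (k * lastC x) * (k * lastC v)) := by
  have h1 : HasFDerivAt (fun y : Euc (n + 1) => k * lastC y)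
      (k • (EuclideanSpace.proj (𝕜 := ℝ) (Fin.last n) : Euc (n + 1) →L[ℝ] ℝ)) x :=
    (hasFDerivAt_last x).const_mul k
  have h2 : HasDerivAt etaF (deriv etaF (k * lastC x)) (k * lastC x) :=
    (etaF_contDiff.differentiable (by simp)).differentiableAt.hasDerivAt
  have h3 := (h2.comp_hasFDerivAt x h1).mul hu.hasFDerivAt
  have h4 : HasFDerivAt (fun y => etaF (k * lastC y) * u y) _ x := h3
  rw [h4.fderiv]
  simp [lastC]

lemma WW_eq {l : ℕ → ℝ} {n : ℕ} {x : Euc (n + 1)}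
    (h : Metric.infDist (frontC x) (gCantorSetPi l n) ≤ 4 * |lastC x|) :
    WW l n x = |lastC x|⁻¹ := by simp [WW, h]

lemma WW_nonneg (l : ℕ → ℝ) (n : ℕ) (x : Euc (n + 1)) : 0 ≤ WW l n x := by
  unfold WW; split_ifs <;> positivity

lemma aesm_u {n : ℕ} {u : Euc (n + 1) → ℝ}
    (hnz : ∀ x, lastC x ≠ 0 → ContDiffAt ℝ (⊤ : ℕ∞) u x) : AEStronglyMeasurable u volume := by
  have h1 : ContinuousOn u {x : Euc (n + 1) | lastC x ≠ 0} := fun x hx =>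
    (hnz x hx).continuousAt.continuousWithinAt
  have h2 := h1.aestronglyMeasurable (μ := volume) open_last.measurableSet
  have h3 : volume.restrict {x : Euc (n + 1) | lastC x ≠ 0} = volume :=
    Measure.restrict_eq_self_of_ae_mem ae_last
  rwa [h3] at h2

lemma weak_u {l : ℕ → ℝ} {n : ℕ} {u : Euc (n + 1) → ℝ} {C : ℝ}
    (hnz : ∀ x, lastC x ≠ 0 → ContDiffAt ℝ (⊤ : ℕ∞) u x)
    (hub : ∀ x, |u x| ≤ 1)
    (hus : ∀ x, u x ≠ 0 → Metric.infDist (frontC x) (gCantorSetPi l n) ≤ 4 * |lastC x|)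
    (hG : ∀ x, lastC x ≠ 0 → ‖fderiv ℝ u x‖ ≤ C * WW l n x)
    (hW : IntegrableOn (WW l n) (Box (n + 1))) :
    HasWeakFDerivOn (Box (n + 1)) u (fun x => fderiv ℝ u x) := by
  intro φ hφ hφc hφs
  obtain ⟨M, hM0, hM⟩ := etaF_deriv_bound
  have hφz : ∀ x, x ∉ Box (n + 1) → φ x = 0 := fun x hx =>
    image_eq_zero_of_notMem_tsupport fun h => hx (hφs h)
  have hφz' : ∀ x, x ∉ Box (n + 1) → fderiv ℝ φ x = 0 := fun x hx => by
    have : x ∉ tsupport (fderiv ℝ φ) := fun h => hx (hφs (tsupport_fderiv_subset ℝ h))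
    exact image_eq_zero_of_notMem_tsupport this
  have hφcont := hφ.continuous
  have hφd : Continuous (fderiv ℝ φ) := hφ.continuous_fderiv (by simp)
  obtain ⟨B, hB⟩ := hφc.exists_bound_of_continuous hφcont
  have hum := aesm_u hnz
  have hWφ : Integrable (fun x => WW l n x * |φ x|) := by
    have h1 : IntegrableOn (fun x => WW l n x * |φ x|) (Box (n + 1)) := by
      refine hW.mul_bdd (c := B) hφcont.abs.aestronglyMeasurable ?_
      exact Eventually.of_forall fun x => by simpa using hB x
    refine (integrableOn_iff_integrable_of_support_subset ?_).1 h1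
    intro x hx
    by_contra h
    exact hx (by simp [hφz x h])
  have hGm : Measurable (fderiv ℝ u) := measurable_fderiv ℝ u
  have hGφ : Integrable (fun x => φ x • fderiv ℝ u x) := by
    refine (hWφ.const_mul C).mono' (hφcont.aestronglyMeasurable.smul hGm.aestronglyMeasurable) ?_
    filter_upwards [ae_last] with x hx
    rw [norm_smul, Real.norm_eq_abs]
    nlinarith [hG x hx, abs_nonneg (φ x)]
  have huφ : Integrable (fun x => u x • fderiv ℝ φ x) := by
    refine ((hφd.integrable_of_hasCompactSupport (hφc.fderiv ℝ)).norm).mono'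
      (hum.smul hφd.aestronglyMeasurable) (Eventually.of_forall fun x => ?_)
    rw [norm_smul, Real.norm_eq_abs]
    nlinarith [hub x, norm_nonneg (fderiv ℝ φ x)]
  rw [setIntegral_eq_integral_of_forall_compl_eq_zero (fun x hx => by rw [hφz' x hx, smul_zero]),
    setIntegral_eq_integral_of_forall_compl_eq_zero (fun x hx => by rw [hφz x hx, zero_smul])]
  ext v
  rw [_root_.neg_apply, ContinuousLinearMap.integral_apply huφ,
    ContinuousLinearMap.integral_apply hGφ]
  simp only [_root_.smul_apply, smul_eq_mul]
  -- cut-offs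
  set uk : ℕ → Euc (n + 1) → ℝ := fun k y => etaF (k * lastC y) * u y with huk
  have hukd : ∀ k, ContDiff ℝ (⊤ : ℕ∞) (uk k) := by
    intro k
    rw [contDiff_iff_contDiffAt]
    intro x
    by_cases hx : lastC x = 0
    · have : uk k =ᶠ[𝓝 x] fun _ => (0 : ℝ) := by
        have hc : ContinuousAt (fun y : Euc (n + 1) => |(k : ℝ) * lastC y|) x :=
          (continuous_const.mul cont_last).abs.continuousAt
        have : ∀ᶠ y in 𝓝 x, |(k : ℝ) * lastC y| < 1 :=
          hc.eventually (gt_mem_nhds (by simp [hx]))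
        filter_upwards [this] with y hy
        simp [huk, etaF_zero hy.le]
      exact contDiffAt_const.congr_of_eventuallyEq this
    · refine ContDiffAt.mul ?_ (hnz x hx)
      have hl : ContDiff ℝ (⊤ : ℕ∞) (lastC : Euc (n + 1) → ℝ) :=
        (EuclideanSpace.proj (𝕜 := ℝ) (Fin.last n) : Euc (n + 1) →L[ℝ] ℝ).contDiff
      exact (etaF_contDiff.comp (contDiff_const.mul hl)).contDiffAt
  have hibp : ∀ k, ∫ x, uk k x * fderiv ℝ φ x v = - ∫ x, fderiv ℝ (uk k) x v * φ x := by
    intro k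
    have hc := (hukd k).continuous
    have hcd : Continuous fun x => fderiv ℝ (uk k) x v :=
      ((hukd k).continuous_fderiv (by simp)).clm_apply continuous_const
    have hpd : Continuous fun x => fderiv ℝ φ x v := hφd.clm_apply continuous_const
    have hpc : HasCompactSupport fun x => fderiv ℝ φ x v := hφc.fderiv_apply ℝ v
    refine integral_mul_fderiv_eq_neg_fderiv_mul_of_integrable ?_ ?_ ?_ ?_ ?_
    · exact (hcd.mul hφcont).integrable_of_hasCompactSupport hφc.mul_left
    · exact (hc.mul hpd).integrable_of_hasCompactSupport hpc.mul_left
    · exact (hc.mul hφcont).integrable_of_hasCompactSupport hφc.mul_left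
    · exact fun x _ => (hukd k).differentiable (by simp) x
    · exact fun x _ => hφ.differentiable (by simp) x
  have hbig : ∀ x : Euc (n + 1), lastC x ≠ 0 → ∀ᶠ k : ℕ in atTop, 2 ≤ |(k : ℝ) * lastC x| := by
    intro x hx
    have ha := abs_pos.2 hx
    have : Tendsto (fun k : ℕ => (k : ℝ) * |lastC x|) atTop atTop :=
      tendsto_natCast_atTop_atTop.atTop_mul_const ha
    filter_upwards [this.eventually_ge_atTop 2] with k hk
    rwa [abs_mul, Nat.abs_cast]
  have hL : Tendsto (fun k => ∫ x, uk k x * fderiv ℝ φ x v) atTop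
      (𝓝 (∫ x, u x * fderiv ℝ φ x v)) := by
    refine tendsto_integral_of_dominated_convergence (fun x => ‖u x * fderiv ℝ φ x v‖) ?_ ?_ ?_ ?_
    · exact fun k => ((hukd k).continuous.mul
        (hφd.clm_apply continuous_const)).aestronglyMeasurable
    · exact (huφ.apply_continuousLinearMap v).norm
    · intro k
      refine Eventually.of_forall fun x => ?_
      simp only [huk, norm_mul, Real.norm_eq_abs]
      have := etaF_abs (k * lastC x)
      have h2 : 0 ≤ |u x| * |fderiv ℝ φ x v| := by positivity
      rw [mul_assoc]
      nlinarith
    · filter_upwards [ae_last] with x hx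
      refine tendsto_const_nhds.congr' ?_
      filter_upwards [hbig x hx] with k hk
      simp [huk, etaF_one (show 3 / 2 ≤ |(k : ℝ) * lastC x| by linarith)]
  have hR : Tendsto (fun k => ∫ x, fderiv ℝ (uk k) x v * φ x) atTop
      (𝓝 (∫ x, φ x * fderiv ℝ u x v)) := by
    refine tendsto_integral_of_dominated_convergence
      (fun x => ((C + M) * ‖v‖) * (WW l n x * |φ x|)) ?_ ?_ ?_ ?_
    · exact fun k => ((((hukd k).continuous_fderiv (by simp)).clm_apply continuous_const).mul
        hφcont).aestronglyMeasurable
    · exact hWφ.const_mul _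
    · intro k
      filter_upwards [ae_last] with x hx
      rw [fderiv_cut (k : ℝ) ((hnz x hx).differentiableAt (by simp)) v, norm_mul, Real.norm_eq_abs,
        Real.norm_eq_abs]
      have hw := WW_nonneg l n x
      have h1 : |etaF (k * lastC x) * fderiv ℝ u x v| ≤ C * WW l n x * ‖v‖ := by
        rw [abs_mul]
        have h2 : |fderiv ℝ u x v| ≤ C * WW l n x * ‖v‖ :=
          ((fderiv ℝ u x).le_opNorm v).trans (by gcongr; exact hG x hx)
        have := etaF_abs (k * lastC x)
        nlinarith [abs_nonneg (fderiv ℝ u x v)]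
      have h3 : |u x * (deriv etaF (k * lastC x) * (k * lastC v))| ≤ M * WW l n x * ‖v‖ := by
        by_cases hu0 : u x = 0
        · rw [hu0]; simp; positivity
        · rw [WW_eq (hus x hu0), abs_mul, abs_mul, abs_mul, Nat.abs_cast]
          have ha := abs_pos.2 hx
          have h4 := hM (k * lastC x)
          rw [abs_mul, Nat.abs_cast] at h4
          have h5 : |deriv etaF (k * lastC x)| * k ≤ M * |lastC x|⁻¹ := by
            rw [← div_eq_mul_inv, le_div_iff₀ ha]; linarith
          calc |u x| * (|deriv etaF (k * lastC x)| * (k * |lastC v|))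
              ≤ 1 * ((|deriv etaF (k * lastC x)| * k) * |lastC v|) := by
                rw [mul_assoc]; gcongr; exact hub x
            _ ≤ 1 * ((M * |lastC x|⁻¹) * ‖v‖) := by gcongr; exact abs_last_le v
            _ = _ := by ring
      have h6 := (abs_add_le (etaF (k * lastC x) * fderiv ℝ u x v)
        (u x * (deriv etaF (k * lastC x) * (k * lastC v)))).trans (add_le_add h1 h3)
      calc _ ≤ (C * WW l n x * ‖v‖ + M * WW l n x * ‖v‖) * |φ x| := by gcongr
        _ = _ := by ring
    · filter_upwards [ae_last] with x hx
      refine tendsto_const_nhds.congr' ?_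
      filter_upwards [hbig x hx] with k hk
      rw [fderiv_cut (k : ℝ) ((hnz x hx).differentiableAt (by simp)) v, etaF_deriv_zero hk,
        etaF_one (show 3 / 2 ≤ |(k : ℝ) * lastC x| by linarith)]
      ring
  refine tendsto_nhds_unique hL ?_
  simp only [hibp]
  exact hR.neg

/-- Integrability properties of the subdimensional competitor
`u = (1/2) sgn(x_d) ρ(x)` (here `d = n+1`, `𝔇 = d − p₀`, `λ = 2^{(1−d)/𝔇}`):
`u ∈ W^{1,1}(Ω)`, `∇u ∈ L^{p₀−ε}(Ω)` for all `ε > 0`, `∇u ∈ L^{p₀,∞}(Ω)` if `γ = 0`, and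
`∇u ∈ L^{p₀}(Ω)` if `γ < −1/𝔇`. -/
theorem subdimensional_competitor_integrability
    {n : ℕ} (hn : 1 ≤ n) (p₀ gam D lam : ℝ) (hp₀ : 1 < p₀) (hp₀d : p₀ < (n : ℝ) + 1)
    (hD : D = ((n : ℝ) + 1) - p₀) (hlam : lam = 2 ^ ((1 - ((n : ℝ) + 1)) / D))
    (l : ℕ → ℝ) (hl : IsCantorLengths lam gam l)
    (ρ : Euc (n + 1) → ℝ)
    (hρsmooth : ContDiffOn ℝ (⊤ : ℕ∞) ρ
      {x : Euc (n + 1) | frontC x ∈ gCantorSetPi l n ∧ lastC x = 0}ᶜ)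
    (hρ1 : ∀ x : Euc (n + 1),
      (if Metric.infDist (frontC x) (gCantorSetPi l n) ≤ 2 * |lastC x| then (1 : ℝ) else 0)
        ≤ ρ x)
    (hρ2 : ∀ x : Euc (n + 1),
      ρ x ≤ if Metric.infDist (frontC x) (gCantorSetPi l n) ≤ 4 * |lastC x| then 1 else 0)
    (hρ3 : ∃ C : ℝ, 0 < C ∧ ∀ x : Euc (n + 1),
      ¬(frontC x ∈ gCantorSetPi l n ∧ lastC x = 0) →
      ‖fderiv ℝ ρ x‖ ≤ C * |lastC x|⁻¹ *
        (if 2 * |lastC x| ≤ Metric.infDist (frontC x) (gCantorSetPi l n) ∧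
            Metric.infDist (frontC x) (gCantorSetPi l n) ≤ 4 * |lastC x| then 1 else 0))
    (u : Euc (n + 1) → ℝ) (hu : ∀ x, u x = (1 / 2) * Real.sign (lastC x) * ρ x) :
    W11On (Box (n + 1)) u (fun x => fderiv ℝ u x) ∧
    (∀ ε : ℝ, 0 < ε → MemLp (fun x => fderiv ℝ u x) (ENNReal.ofReal (p₀ - ε))
      (volume.restrict (Box (n + 1)))) ∧
    (gam = 0 → ∃ C : ℝ, 0 < C ∧ ∀ t : ℝ, 0 < t →
      volume {x ∈ Box (n + 1) | t < ‖fderiv ℝ u x‖} ≤ ENNReal.ofReal (C * t ^ (-p₀))) ∧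
    (gam < -1 / D → MemLp (fun x => fderiv ℝ u x) (ENNReal.ofReal p₀)
      (volume.restrict (Box (n + 1)))) := by
  obtain ⟨C, hC, hρ3⟩ := hρ3
  have hD0 : 0 < D := by rw [hD]; linarith
  have hn0 : (0 : ℝ) < n := by exact_mod_cast hn
  have hlam0 : 0 < lam := by rw [hlam]; positivity
  have hlam1 : lam < 1 := by
    rw [hlam]
    apply Real.rpow_lt_one_of_one_lt_of_neg (by norm_num)
    apply div_neg_of_neg_of_pos _ hD0
    linarith
  have h2D : (2 : ℝ) ^ n * lam ^ D = 1 := by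
    rw [hlam, ← Real.rpow_mul (by norm_num), div_mul_cancel₀ _ hD0.ne', ← Real.rpow_natCast,
      ← Real.rpow_add (by norm_num)]
    simp
  have hρ0 : ∀ x, 0 ≤ ρ x := fun x => le_trans (by split_ifs <;> norm_num) (hρ1 x)
  have hρle : ∀ x, ρ x ≤ 1 := fun x => (hρ2 x).trans (by split_ifs <;> norm_num)
  have hsgn : ∀ t : ℝ, |(1 / 2) * Real.sign t| ≤ 1 := by
    intro t
    rcases Real.sign_apply_eq t with h | h | h <;> rw [h] <;> norm_num
  have hloc : ∀ x, lastC x ≠ 0 →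
      u =ᶠ[𝓝 x] fun y => ((1 / 2) * Real.sign (lastC x)) * ρ y := by
    intro x hx
    rcases lt_or_gt_of_ne hx with h | h
    · have ho : ∀ᶠ y in 𝓝 x, lastC y < 0 := cont_last.continuousAt.eventually (gt_mem_nhds h)
      filter_upwards [ho] with y hy
      rw [hu, Real.sign_of_neg h, Real.sign_of_neg hy]
    · have ho : ∀ᶠ y in 𝓝 x, 0 < lastC y := cont_last.continuousAt.eventually (lt_mem_nhds h)
      filter_upwards [ho] with y hy
      rw [hu, Real.sign_of_pos h, Real.sign_of_pos hy]
  have hρc : ∀ x, lastC x ≠ 0 → ContDiffAt ℝ (⊤ : ℕ∞) ρ x := by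
    intro x hx
    refine hρsmooth.contDiffAt (mem_of_superset (open_last.mem_nhds hx) ?_)
    intro y hy h
    exact hy h.2
  have hnz : ∀ x, lastC x ≠ 0 → ContDiffAt ℝ (⊤ : ℕ∞) u x := fun x hx =>
    (contDiffAt_const.mul (hρc x hx)).congr_of_eventuallyEq (hloc x hx)
  have hub : ∀ x, |u x| ≤ 1 := by
    intro x
    rw [hu, abs_mul, abs_of_nonneg (hρ0 x)]
    have := hsgn (lastC x)
    nlinarith [hρ0 x, hρle x, abs_nonneg ((1 / 2) * Real.sign (lastC x))]
  have hus : ∀ x, u x ≠ 0 →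
      Metric.infDist (frontC x) (gCantorSetPi l n) ≤ 4 * |lastC x| := by
    intro x hx
    by_contra h
    have h1 := hρ2 x
    rw [if_neg h] at h1
    apply hx
    rw [hu, le_antisymm h1 (hρ0 x), mul_zero]
  have hG : ∀ x, lastC x ≠ 0 → ‖fderiv ℝ u x‖ ≤ C * WW l n x := by
    intro x hx
    rw [(hloc x hx).fderiv_eq, fderiv_const_mul ((hρc x hx).differentiableAt (by simp)), norm_smul,
      Real.norm_eq_abs]
    have h1 := hρ3 x (fun h => hx h.2)
    have h2 : C * |lastC x|⁻¹ *
        (if 2 * |lastC x| ≤ Metric.infDist (frontC x) (gCantorSetPi l n) ∧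
            Metric.infDist (frontC x) (gCantorSetPi l n) ≤ 4 * |lastC x| then 1 else 0)
        ≤ C * WW l n x := by
      split_ifs with h
      · rw [WW_eq h.2, mul_one]
      · rw [mul_zero]; exact mul_nonneg hC.le (WW_nonneg l n x)
    have h3 := hsgn (lastC x)
    nlinarith [norm_nonneg (fderiv ℝ ρ x)]
  have hGae : ∀ᵐ x ∂(volume.restrict (Box (n + 1))), ‖fderiv ℝ u x‖ ≤ C * WW l n x := by
    refine ae_restrict_of_ae ?_
    filter_upwards [ae_last] with x hx using hG x hx
  have hGm : ∀ μ : Measure (Euc (n + 1)), AEStronglyMeasurable (fun x => fderiv ℝ u x) μ :=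
    fun μ => (measurable_fderiv ℝ u).aestronglyMeasurable
  have hlift : ∀ p : ℝ≥0∞, MemLp (WW l n) p (volume.restrict (Box (n + 1))) →
      MemLp (fun x => fderiv ℝ u x) p (volume.restrict (Box (n + 1))) := by
    intro p hp
    refine (hp.const_mul C).mono (hGm _) ?_
    filter_upwards [hGae] with x hx
    exact hx.trans (le_abs_self _)
  have hWp : ∀ ε : ℝ, 0 < ε → 0 < p₀ - ε →
      MemLp (WW l n) (ENNReal.ofReal (p₀ - ε)) (volume.restrict (Box (n + 1))) := by
    intro ε hε hp
    apply memLp_WW hl hlam0 hp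
    rw [show (n : ℝ) + 1 - (p₀ - ε) = D + ε by rw [hD]; ring]
    apply cl_summ hl hlam0 (by linarith)
    apply summ_geo (by positivity)
    rw [Real.rpow_add hlam0, ← mul_assoc, h2D, one_mul]
    exact Real.rpow_lt_one hlam0.le hlam1 hε
  have hW1 : MemLp (WW l n) 1 (volume.restrict (Box (n + 1))) := by
    have := hWp (p₀ - 1) (by linarith) (by linarith)
    rwa [_root_.sub_sub_cancel, ENNReal.ofReal_one] at this
  have hBoxfin : volume (Box (n + 1)) < ⊤ := by
    have hsub : Box (n + 1) ⊆ Metric.closedBall (0 : Euc (n + 1)) (√(n + 1)) := by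
      intro x hx
      rw [mem_closedBall_zero_iff, EuclideanSpace.norm_eq]
      apply Real.sqrt_le_sqrt
      calc ∑ i, ‖x i‖ ^ 2 ≤ ∑ _i : Fin (n + 1), (1 : ℝ) := by
            gcongr with i
            have := hx i
            rw [Real.norm_eq_abs]
            nlinarith [abs_nonneg (x i)]
        _ = _ := by simp
    exact (measure_mono hsub).trans_lt measure_closedBall_lt_top
  refine ⟨⟨?_, ?_, ?_⟩, ?_, ?_, ?_⟩
  · have : IsFiniteMeasure (volume.restrict (Box (n + 1))) := ⟨by simpa using hBoxfin⟩
    exact Integrable.of_bound (aesm_u hnz).restrict 1 (Eventually.of_forall hub)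
  · exact memLp_one_iff_integrable.1 (hlift 1 hW1)
  · exact weak_u hnz hub hus hG (memLp_one_iff_integrable.1 hW1)
  · intro ε hε
    rcases le_or_gt (p₀ - ε) 0 with h | h
    · rw [ENNReal.ofReal_of_nonpos h]
      exact memLp_zero_iff_aestronglyMeasurable.2 (hGm _)
    · exact hlift _ (hWp ε hε h)
  · rintro rfl
    obtain ⟨C', hC', hw⟩ := weak_WW (n := n) hl hlam0 hD0 (by rw [hD]; linarith) h2D
    refine ⟨C' * C ^ p₀, by positivity, fun t ht => ?_⟩
    have h1 : volume {x ∈ Box (n + 1) | t < ‖fderiv ℝ u x‖} ≤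
        volume {x ∈ Box (n + 1) | t / C < WW l n x} := by
      apply measure_mono_ae
      filter_upwards [ae_last] with x hx h
      refine ⟨h.1, ?_⟩
      rw [div_lt_iff₀ hC, mul_comm]
      exact lt_of_lt_of_le h.2 (hG x hx)
    refine h1.trans ((hw (t / C) (by positivity)).trans (le_of_eq ?_))
    congr 1
    rw [show (n : ℝ) + 1 - D = p₀ by rw [hD]; ring, Real.div_rpow ht.le hC.le,
      Real.rpow_neg hC.le]
    field_simp
  · intro hg
    apply hlift
    apply memLp_WW hl hlam0 (by linarith)
    rw [← hD]
    apply cl_summ hl hlam0 hD0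
    simp only [h2D, one_pow, one_mul]
    rw [Real.summable_nat_rpow]
    rwa [lt_div_iff₀ hD0] at hg
end

section
/- Let d ≥ 2, 1 < p₀ < d, 𝔇 = d − p₀, λ = 2^{(1−d)/𝔇}, γ ∈ ℝ, and on Ω = (−1,1)^d define the auxiliary function b(x) = 1_{{dist(x̄, 𝔠^{d−1}_{λ,γ}) ≤ |x_d|/2}} · |x_d|^{𝔇+1−d} · (log(e + |x_d|^{−1}))^{−γ𝔇}, where x = (x̄, x_d) ∈ ℝ^{d−1} × ℝ. Then b ∈ L^s(Ω) for every s < p₀' = p₀/(p₀−1). -/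
open MeasureTheory Real Set Metric Filter Topology NNReal ENNReal

lemma aux_l_le {l : ℕ → ℝ} (h0 : l 0 = 1) (h2 : ∀ j, 2 * l (j + 1) < l j) (j : ℕ) :
    l j ≤ (1 / 2) ^ j := by
  induction j with
  | zero => simp [h0]
  | succ k ih => have := h2 k; rw [pow_succ]; linarith

lemma aux_tail {l : ℕ → ℝ} (hpos : ∀ j, 0 < l j) (h2 : ∀ j, 2 * l (j + 1) < l j)
    (ε : ℕ → Bool) (j : ℕ) :
    (∑ i ∈ Finset.range j, if ε i then l i - l (i + 1) else 0) - 1 / 2 ≤ gCantorPoint l ε ∧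
    gCantorPoint l ε ≤
      (∑ i ∈ Finset.range j, if ε i then l i - l (i + 1) else 0) - 1 / 2 + l j := by
  set f : ℕ → ℝ := fun i => if ε i then l i - l (i + 1) else 0 with hf
  have hf0 : ∀ i, 0 ≤ f i := by
    intro i; simp only [hf]; split_ifs
    · have := h2 i; have := hpos (i+1); linarith
    · exact le_rfl
  have hfle : ∀ i, f i ≤ l i - l (i + 1) := by
    intro i; simp only [hf]; split_ifs
    · exact le_rfl
    · have := h2 i; have := hpos (i+1); linarith
  have hsum : ∀ j N, ∑ i ∈ Finset.range N, f (i + j) ≤ l j := by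
    intro j N
    have : ∑ i ∈ Finset.range N, f (i + j) ≤ l j - l (N + j) := by
      induction N with
      | zero => simp
      | succ k ih =>
        rw [Finset.sum_range_succ]
        have := hfle (k + j)
        have e : k + 1 + j = k + j + 1 := by ring
        rw [e]; linarith
    have := hpos (N + j); linarith
  have hs : Summable f := summable_of_sum_range_le hf0 (c := l 0) (fun N => by simpa using hsum 0 N)
  have e := hs.sum_add_tsum_nat_add j
  have t0 : 0 ≤ ∑' i, f (i + j) := tsum_nonneg fun i => hf0 _
  have t1 : ∑' i, f (i + j) ≤ l j :=
    Real.tsum_le_of_sum_range_le (fun i => hf0 _) (hsum j)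
  have e2 : gCantorPoint l ε = -(1/2) + ∑' i, f i := rfl
  rw [e2]
  constructor <;> linarith

lemma aux_vol1 {l : ℕ → ℝ} (hpos : ∀ j, 0 < l j) (h2 : ∀ j, 2 * l (j + 1) < l j)
    (t : ℝ) (j : ℕ) :
    volume {r : ℝ | ∃ c ∈ gCantorSet l, |r - c| ≤ t} ≤ ENNReal.ofReal (2 ^ j * (l j + 2 * t)) := by
  let g : (Fin j → Bool) → ℝ := fun e =>
    (∑ i : Fin j, if e i then l i - l (i + 1) else 0) - 1 / 2
  have hsub : {r : ℝ | ∃ c ∈ gCantorSet l, |r - c| ≤ t} ⊆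
      ⋃ e : Fin j → Bool, Icc (g e - t) (g e + l j + t) := by
    rintro r ⟨c, ⟨ε, rfl⟩, hr⟩
    have := aux_tail hpos h2 ε j
    rw [Finset.sum_range] at this
    refine mem_iUnion.2 ⟨fun i => ε i, ?_⟩
    have h3 := abs_le.1 hr
    simp only [g]
    constructor <;> linarith [this.1, this.2]
  refine (measure_mono hsub).trans ((measure_iUnion_le _).trans ?_)
  simp only [Real.volume_Icc]
  rw [tsum_fintype]
  have : ∀ e : Fin j → Bool, g e + l j + t - (g e - t) = l j + 2 * t := fun e => by ring
  simp only [this, Finset.sum_const, Finset.card_univ, Fintype.card_fun, Fintype.card_bool,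
    Fintype.card_fin]
  rw [ENNReal.ofReal_mul (by positivity), nsmul_eq_mul]
  simp [ENNReal.ofReal_pow]

lemma aux_bdd {n : ℕ} (hn : 1 ≤ n) {gam D lam δ : ℝ} (hD : 0 < D) (hδ : 0 < δ)
    (hlam : lam = 2 ^ ((1 - ((n : ℝ) + 1)) / D))
    {l : ℕ → ℝ} (hl : IsCantorLengths lam gam l) :
    ∃ M : ℝ, 0 < M ∧ ∀ j, l j ^ (D + δ) * (2 ^ j) ^ n ≤ M := by
  obtain ⟨h0, hpos, h2, -, C, hC, hCl⟩ := hl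
  have hn' : (1 : ℝ) ≤ n := by exact_mod_cast hn
  have hl0 : 0 < lam := by rw [hlam]; positivity
  have hl1 : lam < 1 := by
    rw [hlam]; apply Real.rpow_lt_one_of_one_lt_of_neg (by norm_num)
    apply div_neg_of_neg_of_pos _ hD; linarith
  have hlD : lam ^ D = ((2 : ℝ) ^ n)⁻¹ := by
    rw [hlam, ← Real.rpow_mul (by norm_num), div_mul_cancel₀ _ hD.ne', ← Real.rpow_natCast,
      ← Real.rpow_neg (by norm_num)]
    congr 1; ring
  have hT : Tendsto (fun j : ℕ => C ^ (D + δ) * ((j : ℝ) ^ (gam * (D + δ)) * (lam ^ δ) ^ j)) atTop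
      (𝓝 (C ^ (D + δ) * 0)) := by
    apply Filter.Tendsto.const_mul
    have hb : 0 < -(δ * Real.log lam) := by
      have := Real.log_neg hl0 hl1
      nlinarith
    have := (tendsto_rpow_mul_exp_neg_mul_atTop_nhds_zero (gam * (D + δ)) _ hb).comp
      tendsto_natCast_atTop_atTop
    refine this.congr fun j => ?_
    simp only [Function.comp]
    rw [Real.rpow_def_of_pos hl0, ← Real.exp_nat_mul]
    congr 2; ring
  obtain ⟨M, hM⟩ := hT.bddAbove_range
  refine ⟨max M 1, by positivity, fun j => ?_⟩
  rcases Nat.eq_zero_or_pos j with rfl | hj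
  · simp [h0]
  refine le_trans ?_ ((hM ⟨j, rfl⟩).trans (le_max_left _ _))
  have hjr : (0 : ℝ) < j := by exact_mod_cast hj
  have hu := (hCl j hj).2
  have hCp : 0 < C := by linarith
  calc l j ^ (D + δ) * (2 ^ j) ^ n
      ≤ (C * lam ^ j * (j : ℝ) ^ gam) ^ (D + δ) * (2 ^ j) ^ n := by
        gcongr; exact (hpos j).le
    _ = _ := by
        rw [Real.mul_rpow (by positivity) (by positivity), Real.mul_rpow (by positivity) (by positivity),
          ← Real.rpow_mul hjr.le]
        have e1 : (lam ^ j) ^ (D + δ) = (lam ^ D) ^ j * (lam ^ δ) ^ j := by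
          rw [← mul_pow, ← Real.rpow_add hl0, ← Real.rpow_natCast, ← Real.rpow_natCast,
            ← Real.rpow_mul hl0.le, ← Real.rpow_mul hl0.le, mul_comm]
        rw [e1, hlD]
        have : (((2 : ℝ) ^ n)⁻¹) ^ j * (2 ^ j) ^ n = 1 := by
          rw [inv_pow, ← pow_mul, ← pow_mul, mul_comm n j, inv_mul_cancel₀ (by positivity)]
        linear_combination (C ^ (D + δ) * (lam ^ δ) ^ j * (j : ℝ) ^ (gam * (D + δ))) * this

lemma aux_voln {n : ℕ} (hn : 1 ≤ n) {gam D lam δ : ℝ} (hD : 0 < D) (hδ : 0 < δ)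
    (hlam : lam = 2 ^ ((1 - ((n : ℝ) + 1)) / D))
    {l : ℕ → ℝ} (hl : IsCantorLengths lam gam l) :
    ∃ M : ℝ, 0 < M ∧ ∀ t : ℝ, 0 < t → t < 1 →
      volume {y : Fin n → ℝ | infDist (WithLp.toLp 2 y : Euc n) (gCantorSetPi l n) ≤ t / 2} ≤
        ENNReal.ofReal (M * t ^ ((n : ℝ) - D - δ)) := by
  obtain ⟨M, hM0, hM⟩ := aux_bdd hn hD hδ hlam hl
  obtain ⟨h0, hpos, h2, -, -⟩ := hl
  refine ⟨6 ^ n * M, by positivity, fun t ht ht1 => ?_⟩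
  have hex : ∃ j, l (j + 1) < t := by
    obtain ⟨j, hj⟩ := exists_pow_lt_of_lt_one ht (show (1 / 2 : ℝ) < 1 by norm_num)
    refine ⟨j, ?_⟩
    have := aux_l_le h0 h2 j
    have := h2 j; have := hpos (j + 1); linarith
  classical
  obtain ⟨j, hj1, hj2⟩ : ∃ j, l (j + 1) < t ∧ t ≤ l j := by
    refine ⟨Nat.find hex, Nat.find_spec hex, ?_⟩
    rcases hk : Nat.find hex with _ | k
    · rw [h0]; exact ht1.le
    · have := Nat.find_min hex (m := k) (by omega)
      linarith
  have hne : (gCantorSetPi l n).Nonempty :=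
    ⟨WithLp.toLp 2 fun _ => gCantorPoint l fun _ => true, fun i => ⟨_, rfl⟩⟩
  have hsub : {y : Fin n → ℝ | infDist (WithLp.toLp 2 y : Euc n) (gCantorSetPi l n) ≤ t / 2} ⊆
      Set.pi univ fun _ => {r : ℝ | ∃ c ∈ gCantorSet l, |r - c| ≤ t} := by
    intro y hy i _
    have hy' : infDist (WithLp.toLp 2 y : Euc n) (gCantorSetPi l n) < t :=
      lt_of_le_of_lt hy (by linarith)
    obtain ⟨c, hc, hd⟩ := (infDist_lt_iff hne).1 hy'
    refine ⟨c i, hc i, ?_⟩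
    rw [dist_eq_norm] at hd
    have := PiLp.norm_apply_le ((WithLp.toLp 2 y : Euc n) - c) i
    simp only [PiLp.sub_apply, Real.norm_eq_abs] at this
    exact this.trans hd.le
  refine (measure_mono hsub).trans ?_
  rw [volume_pi_pi]
  simp only [Finset.prod_const, Finset.card_univ, Fintype.card_fin]
  calc _ ≤ (ENNReal.ofReal (2 ^ (j + 1) * (l (j + 1) + 2 * t))) ^ n := by
        gcongr; exact aux_vol1 hpos h2 t (j + 1)
    _ = ENNReal.ofReal ((2 ^ (j + 1) * (l (j + 1) + 2 * t)) ^ n) := by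
        rw [ENNReal.ofReal_pow]; have := hpos (j + 1); positivity
    _ ≤ _ := by
        apply ENNReal.ofReal_le_ofReal
        have hp := hpos (j + 1)
        calc (2 ^ (j + 1) * (l (j + 1) + 2 * t)) ^ n ≤ (2 ^ (j + 1) * (3 * t)) ^ n := by
              gcongr; linarith
          _ = 6 ^ n * (t ^ (D + δ) * (2 ^ j) ^ n) * t ^ ((n : ℝ) - D - δ) := by
              have : t ^ (D + δ) * t ^ ((n : ℝ) - D - δ) = t ^ n := by
                rw [← Real.rpow_add ht, ← Real.rpow_natCast]; congr 1; ring
              have e : (2 : ℝ) ^ (j + 1) * (3 * t) = 6 * t * 2 ^ j := by ring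
              rw [e, mul_pow, mul_pow, ← this]; ring
          _ ≤ 6 ^ n * M * t ^ ((n : ℝ) - D - δ) := by
              gcongr
              refine le_trans ?_ (hM j)
              gcongr

lemma aux_log {a ε : ℝ} (hε : 0 < ε) :
    ∃ C : ℝ, 0 < C ∧ ∀ t : ℝ, 0 < t → t < 1 →
      Real.log (Real.exp 1 + t⁻¹) ^ a ≤ C * t ^ (-ε) := by
  set A := |a| + 1 with hA
  have hA0 : 0 < A := by positivity
  set δ := ε / A with hδ
  have hδ0 : 0 < δ := by positivity
  refine ⟨(4 ^ δ / δ) ^ A, by positivity, fun t ht ht1 => ?_⟩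
  have hti : 1 ≤ t⁻¹ := (one_le_inv₀ ht).2 ht1.le
  have he := Real.exp_one_lt_three
  have he0 := Real.exp_pos 1
  have h1 : 1 ≤ Real.log (Real.exp 1 + t⁻¹) := by
    rw [Real.le_log_iff_exp_le (by positivity)]; linarith
  have h2 : Real.log (Real.exp 1 + t⁻¹) ≤ 4 ^ δ / δ * t ^ (-δ) := by
    calc Real.log (Real.exp 1 + t⁻¹) ≤ Real.log (4 * t⁻¹) := by
          apply Real.log_le_log (by positivity); linarith
      _ ≤ (4 * t⁻¹) ^ δ / δ := Real.log_le_rpow_div (by positivity) hδ0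
      _ = _ := by
        rw [Real.mul_rpow (by norm_num) (by positivity), Real.inv_rpow ht.le,
          Real.rpow_neg ht.le]; ring
  calc Real.log (Real.exp 1 + t⁻¹) ^ a ≤ Real.log (Real.exp 1 + t⁻¹) ^ A :=
        Real.rpow_le_rpow_of_exponent_le h1 (by linarith [le_abs_self a])
    _ ≤ (4 ^ δ / δ * t ^ (-δ)) ^ A := by gcongr
    _ = _ := by
        rw [Real.mul_rpow (by positivity) (by positivity), ← Real.rpow_mul ht.le]
        congr 2; rw [hδ]; field_simp

lemma aux_int {r : ℝ} (hr : -1 < r) :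
    ∫⁻ t in Ioo (-1 : ℝ) 1, ENNReal.ofReal (|t| ^ r) < ⊤ := by
  have hI : IntegrableOn (fun t : ℝ => |t| ^ r) (Ioo (0 : ℝ) 1) := by
    have h := (intervalIntegral.intervalIntegrable_rpow' (a := 0) (b := 1) hr)
    rw [intervalIntegrable_iff_integrableOn_Ioo_of_le zero_le_one] at h
    refine h.congr_fun (fun t ht => ?_) measurableSet_Ioo
    simp only [abs_of_pos ht.1]
  have hN : IntegrableOn (fun t : ℝ => |t| ^ r) (Ioo (-1 : ℝ) 0) := by
    have := ((Measure.measurePreserving_neg (volume : Measure ℝ)).integrableOn_comp_preimage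
      (Homeomorph.neg ℝ).measurableEmbedding (f := fun t : ℝ => |t| ^ r) (s := Ioo (0 : ℝ) 1)).2 hI
    simpa [Function.comp_def] using this
  have hU : IntegrableOn (fun t : ℝ => |t| ^ r) (Ioo (-1 : ℝ) 1) := by
    have := (hN.union hI).union (integrableOn_singleton (f := fun t : ℝ => |t| ^ r) (x := (0:ℝ)) (μ := volume) (by simp) (by simp))
    refine this.mono_set fun t ht => ?_
    rcases lt_trichotomy t 0 with h | h | h
    · exact Or.inl (Or.inl ⟨ht.1, h⟩)
    · exact Or.inr h
    · exact Or.inl (Or.inr ⟨h, ht.2⟩)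
  have := hU.2
  rw [hasFiniteIntegral_iff_ofReal (ae_of_all _ fun t => by positivity)] at this
  exact this

/-- The auxiliary function
`b = 1_{dist(x̄,𝔠^{d−1}_{λ,γ}) ≤ |x_d|/2} |x_d|^{𝔇+1−d} (log(e+|x_d|⁻¹))^{−γ𝔇}`
belongs to `L^s(Ω)` for every `s < p₀' = p₀/(p₀−1)` (here `d = n+1`, `𝔇 = d − p₀`,
`λ = 2^{(1−d)/𝔇}`). -/
theorem auxiliary_b_integrability
    {n : ℕ} (hn : 1 ≤ n) (p₀ gam D lam : ℝ) (hp₀ : 1 < p₀) (hp₀d : p₀ < (n : ℝ) + 1)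
    (hD : D = ((n : ℝ) + 1) - p₀) (hlam : lam = 2 ^ ((1 - ((n : ℝ) + 1)) / D))
    (l : ℕ → ℝ) (hl : IsCantorLengths lam gam l)
    (b : Euc (n + 1) → ℝ)
    (hb : ∀ x : Euc (n + 1), b x =
      (if Metric.infDist (frontC x) (gCantorSetPi l n) ≤ |lastC x| / 2 then (1 : ℝ) else 0) *
        |lastC x| ^ (D + 1 - ((n : ℝ) + 1)) *
        Real.log (Real.exp 1 + |lastC x|⁻¹) ^ (-(gam * D))) :
    ∀ s : ℝ, 0 < s → s < p₀ / (p₀ - 1) →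
      MemLp b (ENNReal.ofReal s) (volume.restrict (Box (n + 1))) := by
  intro s hs hsp
  have hn' : (1 : ℝ) ≤ n := by exact_mod_cast hn
  have hD0 : 0 < D := by rw [hD]; linarith
  have hs' : s * (p₀ - 1) < p₀ := (lt_div_iff₀ (by linarith)).1 hsp
  set ε := (p₀ - s * (p₀ - 1)) / (2 * (s + 1)) with hε
  have hε0 : 0 < ε := by apply div_pos <;> linarith
  have hεs : ε * (s + 1) = (p₀ - s * (p₀ - 1)) / 2 := by rw [hε]; field_simp
  obtain ⟨M, hM0, hM⟩ := aux_voln hn hD0 hε0 hlam hl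
  obtain ⟨C, hC0, hC⟩ := aux_log (a := -(gam * D)) hε0
  have hexp : D + 1 - ((n : ℝ) + 1) = 1 - p₀ := by rw [hD]; ring
  have hfront : Continuous (frontC : Euc (n + 1) → Euc n) := by
    unfold frontC
    fun_prop
  have hlast : Continuous (lastC : Euc (n + 1) → ℝ) := by
    unfold lastC
    fun_prop
  have hbm : Measurable b := by
    have : b = fun x : Euc (n + 1) => _ := funext hb
    rw [this]
    refine Measurable.mul (Measurable.mul (Measurable.ite ?_ measurable_const measurable_const) ?_) ?_
    · exact measurableSet_le ((continuous_infDist_pt _).comp hfront).measurable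
        (hlast.abs.measurable.div_const 2)
    · exact hlast.abs.measurable.pow_const _
    · exact (Real.measurable_log.comp
        (measurable_const.add hlast.abs.measurable.inv)).pow_const _
  refine ⟨hbm.aestronglyMeasurable, ?_⟩
  rw [eLpNorm_lt_top_iff_lintegral_rpow_enorm_lt_top (by simpa using hs) ENNReal.ofReal_ne_top,
    ENNReal.toReal_ofReal hs.le]
  let A : Set (ℝ × (Fin n → ℝ)) := {p | 0 < |p.1| ∧ |p.1| < 1 ∧
    infDist (WithLp.toLp 2 p.2 : Euc n) (gCantorSetPi l n) ≤ |p.1| / 2}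
  have hAm : MeasurableSet A := by
    have ha : Measurable fun p : ℝ × (Fin n → ℝ) => |p.1| :=
      (measurable_norm (α := ℝ)).comp measurable_fst
    refine MeasurableSet.inter (measurableSet_lt measurable_const ha)
      (MeasurableSet.inter (measurableSet_lt ha measurable_const) ?_)
    refine measurableSet_le ?_ (ha.div_const 2)
    refine ((continuous_infDist_pt _).comp ?_).measurable
    fun_prop
  let G : ℝ → ℝ≥0∞ := fun t => ENNReal.ofReal (C ^ s * |t| ^ ((1 - p₀ - ε) * s))
  have hGm : Measurable G := by
    refine ENNReal.measurable_ofReal.comp (Measurable.const_mul ?_ _)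
    exact (measurable_norm (α := ℝ)).pow_const _
  let F : ℝ × (Fin n → ℝ) → ℝ≥0∞ := A.indicator fun p => G p.1
  have hFm : Measurable F := (hGm.comp measurable_fst).indicator hAm
  let e : Euc (n + 1) → ℝ × (Fin n → ℝ) := fun x => (lastC x, WithLp.ofLp (frontC x))
  have he : MeasurePreserving e := by
    have h1 := EuclideanSpace.volume_preserving_symm_measurableEquiv_toLp (Fin (n + 1))
    have h2 := volume_preserving_piFinSuccAbove (fun _ : Fin (n + 1) => ℝ) (Fin.last n)
    have h3 := h2.comp h1
    convert! h3 using 1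
    ext x i
    · rfl
    · simp [e, frontC, MeasurableEquiv.piFinSuccAbove, Fin.insertNthEquiv]
      rfl
  have hBm : MeasurableSet (Box (n + 1)) := by
    have : Box (n + 1) = ⋂ i, {x : Euc (n + 1) | |x i| < 1} := by ext; simp [Box]
    rw [this]
    exact MeasurableSet.iInter fun i => measurableSet_lt (by fun_prop) measurable_const
  have hpt : ∀ x ∈ Box (n + 1), ‖b x‖ₑ ^ s ≤ F (e x) := by
    intro x hx
    have hx1 : |lastC x| < 1 := hx _
    rcases eq_or_lt_of_le (abs_nonneg (lastC x)) with h0 | h0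
    · have : b x = 0 := by
        rw [hb, ← h0, hexp, Real.zero_rpow (by linarith)]; simp
      rw [this]; simp [hs]
    by_cases hd : infDist (frontC x) (gCantorSetPi l n) ≤ |lastC x| / 2
    · have hmem : e x ∈ A := ⟨h0, hx1, hd⟩
      simp only [F, indicator_of_mem hmem]
      have hbx : b x = |lastC x| ^ (1 - p₀) *
          Real.log (Real.exp 1 + |lastC x|⁻¹) ^ (-(gam * D)) := by
        rw [hb, if_pos hd, hexp, one_mul]
      have hlog : 0 ≤ Real.log (Real.exp 1 + |lastC x|⁻¹) := by
        apply Real.log_nonneg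
        have := Real.add_one_le_exp 1
        have : 0 < |lastC x|⁻¹ := by positivity
        linarith
      have hbn : 0 ≤ b x := by rw [hbx]; positivity
      have hble : b x ≤ C * |lastC x| ^ (1 - p₀ - ε) := by
        rw [hbx, sub_eq_add_neg _ ε, Real.rpow_add h0]
        have := hC _ h0 hx1
        calc _ ≤ |lastC x| ^ (1 - p₀) * (C * |lastC x| ^ (-ε)) := by gcongr
          _ = _ := by ring
      rw [Real.enorm_of_nonneg hbn, ENNReal.ofReal_rpow_of_nonneg hbn hs.le]
      apply ENNReal.ofReal_le_ofReal
      calc b x ^ s ≤ (C * |lastC x| ^ (1 - p₀ - ε)) ^ s := by gcongr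
        _ = _ := by
          rw [Real.mul_rpow hC0.le (by positivity), ← Real.rpow_mul (abs_nonneg _)]
    · have : b x = 0 := by rw [hb, if_neg hd]; simp
      rw [this]; simp [hs]
  have hinner : ∀ t : ℝ, ∫⁻ y, F (t, y) ≤ (Ioo (-1 : ℝ) 1).indicator
      (fun t => ENNReal.ofReal (C ^ s * M) *
        ENNReal.ofReal (|t| ^ ((1 - p₀ - ε) * s + (p₀ - 1 - ε)))) t := by
    intro t
    by_cases ht : 0 < |t| ∧ |t| < 1
    · obtain ⟨h0, h1⟩ := ht
      rw [indicator_of_mem (show t ∈ Ioo (-1 : ℝ) 1 from abs_lt.1 h1)]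
      calc ∫⁻ y, F (t, y) ≤ ∫⁻ y, {y : Fin n → ℝ | infDist (WithLp.toLp 2 y : Euc n)
              (gCantorSetPi l n) ≤ |t| / 2}.indicator (fun _ => G t) y := by
            refine lintegral_mono fun y => ?_
            by_cases hy : (t, y) ∈ A
            · simp only [F]
              have hy2 : y ∈ {y : Fin n → ℝ | infDist (WithLp.toLp 2 y : Euc n)
                (gCantorSetPi l n) ≤ |t| / 2} := hy.2.2
              rw [indicator_of_mem hy, indicator_of_mem hy2]
            · simp only [F]
              rw [indicator_of_notMem hy]; exact zero_le
        _ ≤ G t * volume {y : Fin n → ℝ | infDist (WithLp.toLp 2 y : Euc n)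
              (gCantorSetPi l n) ≤ |t| / 2} := lintegral_indicator_const_le _ _
        _ ≤ G t * ENNReal.ofReal (M * |t| ^ ((n : ℝ) - D - ε)) := by
            gcongr; exact hM _ h0 h1
        _ = _ := by
            simp only [G]
            rw [← ENNReal.ofReal_mul (by positivity), ← ENNReal.ofReal_mul (by positivity),
              Real.rpow_add h0]
            congr 1
            have : (n : ℝ) - D - ε = p₀ - 1 - ε := by rw [hD]; ring
            rw [this]; ring
    · have : ∀ y, F (t, y) = 0 := fun y => by
        simp only [F]
        exact indicator_of_notMem (fun h => ht ⟨h.1, h.2.1⟩) _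
      simp [this]
  calc ∫⁻ x in Box (n + 1), ‖b x‖ₑ ^ s ≤ ∫⁻ x in Box (n + 1), F (e x) :=
        setLIntegral_mono' hBm hpt
    _ ≤ ∫⁻ x, F (e x) := setLIntegral_le_lintegral _ _
    _ = ∫⁻ p, F p := he.lintegral_comp hFm
    _ = ∫⁻ t, ∫⁻ y, F (t, y) := lintegral_prod _ hFm.aemeasurable
    _ ≤ _ := lintegral_mono hinner
    _ = ENNReal.ofReal (C ^ s * M) * ∫⁻ t in Ioo (-1 : ℝ) 1,
        ENNReal.ofReal (|t| ^ ((1 - p₀ - ε) * s + (p₀ - 1 - ε))) := by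
        rw [lintegral_indicator measurableSet_Ioo, lintegral_const_mul' _ _ ENNReal.ofReal_ne_top]
    _ < ⊤ := by
        refine ENNReal.mul_lt_top ENNReal.ofReal_lt_top (aux_int ?_)
        nlinarith
end
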